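/- Assume J_ρ ≠ 𝒥, let J ⊆ 𝒥 and let j ∈ J_ρ. For J′ ⊆ 𝒥 put S_1(J′) = #{i ≥ 0 : j ∈ δ_ss^i(J′) and j+1 ∉ δ_ss^i(J′)} and S_2(J′) = #{i ≥ 0 : j ∉ δ_ss^i(J′) and j+1 ∈ δ_ss^i(J′)} (these sets are finite). Then (S_1(J) − S_1(J^{ss})) − (S_2(J) − S_2(J^{ss})) = 0, and moreover S_2(J) − S_2(J^{ss}) = 1_{j+k(j) ∈ ∂(J^c)}. -/

import Mathlib

open Finset
open scoped symmDiff

def shiftSet (f : ℕ) (J : Finset (ZMod f)) (k : ℤ) : Finset (ZMod f) :=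
  J.image (fun j => j + (k : ZMod f))

def deltaSS (f : ℕ) (Jrho J : Finset (ZMod f)) : Finset (ZMod f) :=
  shiftSet f J (-1) ∩ Jrho

def sfun (p f : ℕ) (r : ZMod f → ℤ) (Jrho J : Finset (ZMod f)) (j : ZMod f) : ℤ :=
  if j ∈ J then
    if j + 1 ∈ J then (if j ∈ Jrho then (p : ℤ) - 3 - r j else (p : ℤ) - 1 - r j)
    else r j + 1
  else
    if j + 1 ∈ J then (p : ℤ) - 2 - r j else r j

def tfun (f : ℕ) (r : ZMod f → ℤ) (Jrho J : Finset (ZMod f)) (j : ZMod f) : ℤ :=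
  if j ∈ J then
    if j + 1 ∈ J then (if j ∈ Jrho then r j + 1 else r j)
    else -1
  else
    if j + 1 ∈ J then r j + 1 else 0


def Sone (f : ℕ) (Jrho : Finset (ZMod f)) (j : ZMod f) (J' : Finset (ZMod f)) : Set ℕ :=
  {i : ℕ | j ∈ (deltaSS f Jrho)^[i] J' ∧ j + 1 ∉ (deltaSS f Jrho)^[i] J'}

def Stwo (f : ℕ) (Jrho : Finset (ZMod f)) (j : ZMod f) (J' : Finset (ZMod f)) : Set ℕ :=
  {i : ℕ | j ∉ (deltaSS f Jrho)^[i] J' ∧ j + 1 ∈ (deltaSS f Jrho)^[i] J'}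

theorem mem_deltaSS (f : ℕ) (Jrho J : Finset (ZMod f)) (x : ZMod f) :
    x ∈ deltaSS f Jrho J ↔ x ∈ Jrho ∧ x + 1 ∈ J := by
  simp only [deltaSS, shiftSet, mem_inter, mem_image]
  constructor
  · rintro ⟨⟨y, hy, rfl⟩, h⟩
    exact ⟨h, by simpa using hy⟩
  · rintro ⟨h, hx⟩
    exact ⟨⟨x + 1, hx, by simp⟩, h⟩

theorem mem_deltaSS_iterate (f : ℕ) (Jrho J : Finset (ZMod f)) (i : ℕ) (x : ZMod f) :
    x ∈ (deltaSS f Jrho)^[i] J ↔ (∀ m < i, x + (m : ZMod f) ∈ Jrho) ∧ x + (i : ZMod f) ∈ J := by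
  induction i generalizing x with
  | zero => simp
  | succ i ih =>
    rw [Function.iterate_succ_apply', mem_deltaSS, ih, Nat.forall_lt_succ_left]
    simp [add_assoc, add_comm (1 : ZMod f), and_assoc]

/-- If `x, …, x + n - 1` is the maximal run in `J_ρ` starting at `x`, then only the iterates
`δ_ss^i` with `i ≤ n` can contain `x`. -/
theorem mem_deltaSS_iterate_of_run (f : ℕ) (Jrho J : Finset (ZMod f)) (x : ZMod f) (n : ℕ)
    (hrun : ∀ m < n, x + (m : ZMod f) ∈ Jrho) (hend : x + (n : ZMod f) ∉ Jrho) (i : ℕ) :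
    x ∈ (deltaSS f Jrho)^[i] J ↔ i ≤ n ∧ x + (i : ZMod f) ∈ J := by
  rw [mem_deltaSS_iterate]
  refine and_congr_left fun _ => ⟨fun h => ?_, fun h m hm => hrun m (hm.trans_le h)⟩
  by_contra! hlt
  exact hend (h n hlt)

/-- A set of naturals below `n` is finite, and its cardinality is a sum of indicators. -/
theorem finite_and_ncard_eq_sum (s : Set ℕ) [DecidablePred (· ∈ s)] (n : ℕ)
    (hs : ∀ i ∈ s, i < n) :
    s.Finite ∧ (s.ncard : ℤ) = ∑ i ∈ range n, if i ∈ s then 1 else 0 := by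
  have h : s = ((range n).filter (· ∈ s) : Finset ℕ) := by
    ext i
    simpa using hs i
  refine ⟨h ▸ Finset.finite_toSet _, ?_⟩
  conv_lhs => rw [h, Set.ncard_coe_finset, Finset.card_filter]
  push_cast
  rfl

/-- the case `j ∈ J_ρ`. -/
theorem statement10 (f : ℕ) [NeZero f] (hf : 1 ≤ f) (Jrho : Finset (ZMod f))
    (hJrho : Jrho ≠ Finset.univ)
    (J : Finset (ZMod f)) (j : ZMod f) (hj : j ∈ Jrho)
    (k : ℕ) (hkf : k < f)
    (hk1 : ∀ i : ℕ, 1 ≤ i → i ≤ k → j + (i : ZMod f) ∈ Jrho)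
    (hk2 : j + (k : ZMod f) + 1 ∉ Jrho) :
    (Sone f Jrho j J).Finite ∧ (Stwo f Jrho j J).Finite ∧
    (Sone f Jrho j (J ∩ Jrho)).Finite ∧ (Stwo f Jrho j (J ∩ Jrho)).Finite ∧
    (((Sone f Jrho j J).ncard : ℤ) - ((Sone f Jrho j (J ∩ Jrho)).ncard : ℤ))
      - (((Stwo f Jrho j J).ncard : ℤ) - ((Stwo f Jrho j (J ∩ Jrho)).ncard : ℤ)) = 0 ∧
    ((Stwo f Jrho j J).ncard : ℤ) - ((Stwo f Jrho j (J ∩ Jrho)).ncard : ℤ)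
      = (if j + (k : ZMod f) ∈ Jᶜ \ shiftSet f Jᶜ (-1) then 1 else 0) := by
  classical
  have hrun : ∀ m < k + 1, j + (m : ZMod f) ∈ Jrho := by
    intro m hm
    rcases Nat.eq_zero_or_pos m with rfl | h
    · simpa using hj
    · exact hk1 m h (by omega)
  have hend : j + ((k + 1 : ℕ) : ZMod f) ∉ Jrho := by
    simpa [add_assoc] using hk2
  have hmem (J' : Finset (ZMod f)) (i : ℕ) :
      j ∈ (deltaSS f Jrho)^[i] J' ↔ i ≤ k + 1 ∧ j + (i : ZMod f) ∈ J' :=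
    mem_deltaSS_iterate_of_run f Jrho J' j (k + 1) hrun hend i
  have hmem_succ (J' : Finset (ZMod f)) (i : ℕ) :
      j + 1 ∈ (deltaSS f Jrho)^[i] J' ↔ i ≤ k ∧ j + ((i + 1 : ℕ) : ZMod f) ∈ J' := by
    have hadd (m : ℕ) : j + 1 + (m : ZMod f) = j + ((m + 1 : ℕ) : ZMod f) := by
      push_cast; ring
    rw [mem_deltaSS_iterate_of_run f Jrho J' (j + 1) k _ _ i, hadd]
    · intro m hm
      rw [hadd]
      exact hrun _ (by omega)
    · rwa [hadd]
  have hone (J' : Finset (ZMod f)) (i : ℕ) : i ∈ Sone f Jrho j J' ↔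
      (i ≤ k + 1 ∧ j + (i : ZMod f) ∈ J') ∧ ¬(i ≤ k ∧ j + ((i + 1 : ℕ) : ZMod f) ∈ J') := by
    rw [← hmem, ← hmem_succ]; rfl
  have htwo (J' : Finset (ZMod f)) (i : ℕ) : i ∈ Stwo f Jrho j J' ↔
      ¬(i ≤ k + 1 ∧ j + (i : ZMod f) ∈ J') ∧ (i ≤ k ∧ j + ((i + 1 : ℕ) : ZMod f) ∈ J') := by
    rw [← hmem, ← hmem_succ]; rfl
  have hcard_one (J' : Finset (ZMod f)) := finite_and_ncard_eq_sum (Sone f Jrho j J') (k + 2)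
    fun i hi => by have := (hone J' i).1 hi; omega
  have hcard_two (J' : Finset (ZMod f)) := finite_and_ncard_eq_sum (Stwo f Jrho j J') (k + 2)
    fun i hi => by have := (htwo J' i).1 hi; omega
  have hsum_one : ∑ i ∈ range k, (if i ∈ Sone f Jrho j (J ∩ Jrho) then (1 : ℤ) else 0) =
      ∑ i ∈ range k, if i ∈ Sone f Jrho j J then 1 else 0 := by
    refine sum_congr rfl fun i hi => ?_
    have hik := mem_range.1 hi
    have h₀ := hrun i (by omega)
    have h₁ := hrun (i + 1) (by omega)
    simp only [hone, mem_inter, h₀, h₁, and_true]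
  have hsum_two : ∑ i ∈ range k, (if i ∈ Stwo f Jrho j (J ∩ Jrho) then (1 : ℤ) else 0) =
      ∑ i ∈ range k, if i ∈ Stwo f Jrho j J then 1 else 0 := by
    refine sum_congr rfl fun i hi => ?_
    have hik := mem_range.1 hi
    have h₀ := hrun i (by omega)
    have h₁ := hrun (i + 1) (by omega)
    simp only [htwo, mem_inter, h₀, h₁, and_true]
  have hboundary : j + (k : ZMod f) ∈ Jᶜ \ shiftSet f Jᶜ (-1) ↔
      j + (k : ZMod f) ∉ J ∧ j + ((k + 1 : ℕ) : ZMod f) ∈ J := by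
    simp [shiftSet, ← sub_eq_add_neg, sub_eq_iff_eq_add, add_assoc]
  have hk := hrun k (by omega)
  refine ⟨(hcard_one J).1, (hcard_two J).1, (hcard_one _).1, (hcard_two _).1, ?_⟩
  rw [(hcard_one J).2, (hcard_two J).2, (hcard_one (J ∩ Jrho)).2, (hcard_two (J ∩ Jrho)).2]
  simp only [sum_range_succ, hsum_one, hsum_two, hboundary]
  simp only [hone, htwo, mem_inter, hk, hend]
  by_cases h₀ : j + (k : ZMod f) ∈ J <;> by_cases h₁ : j + ((k + 1 : ℕ) : ZMod f) ∈ J <;>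
    simp [h₀, h₁, -Nat.cast_add]
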